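/- arXiv:2603.10589 — 3 statements merged into one kernel-verified Lean document; each statement's English description precedes it below -/
import Mathlib

section
/- Let c : ℕ ≃ ℕ be a bijection with c ∘ S ∘ c⁻¹ primitive recursive (where S x = x + 1) and such that the binary function (x, y) ↦ c (c⁻¹ x + c⁻¹ y) is primitive recursive, and let d : ℕ ≃ ℕ be a bijection satisfying: for all n, i ∈ ℕ, the i-th binary bit of d n equals the (c⁻¹ i)-th binary bit of n. Then the binary function (x, y) ↦ d (d⁻¹ x · d⁻¹ y) is primitive recursive. -/
theorem primrec₂_pow : Primrec₂ (fun x y : ℕ => x ^ y) := by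
  refine (Primrec.nat_rec (f := fun _ : ℕ => 1) (g := fun (x : ℕ) (p : ℕ × ℕ) => p.2 * x)
    (Primrec.const 1) ?_).of_eq ?_
  · exact Primrec.nat_mul.comp (Primrec.snd.comp Primrec.snd) Primrec.fst
  · intro x n
    induction n with
    | zero => simp
    | succ n ih => simpa [pow_succ] using congrArg (· * x) ih

theorem primrecPred_testBit : PrimrecPred (fun p : ℕ × ℕ => Nat.testBit p.1 p.2 = true) := by
  have h : PrimrecPred (fun p : ℕ × ℕ => p.1 / 2 ^ p.2 % 2 = 1) :=
    Primrec.eq.comp (Primrec.nat_mod.comp (Primrec.nat_div.comp Primrec.fst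
      (primrec₂_pow.comp (Primrec.const 2) Primrec.snd)) (Primrec.const 2)) (Primrec.const 1)
  exact h.of_eq fun p => by simp [Nat.testBit_eq_decide_div_mod_eq]

theorem Nat.add_two_pow_eq_lor {n i : ℕ} (h : n.testBit i = false) : n + 2 ^ i = n ||| 2 ^ i := by
  induction i generalizing n with
  | zero =>
    have h0 : n % 2 = 0 := Nat.mod_two_eq_zero_iff_testBit_zero.2 h
    have h1 : (n ||| 1) / 2 = n / 2 := by simp [Nat.or_div_two]
    have h2 : (n ||| 1) % 2 = 1 := by simp
    rw [pow_zero]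
    omega
  | succ i ih =>
    have h1 : (n ||| 2 ^ (i + 1)) / 2 = n / 2 ||| 2 ^ i := by simp [Nat.or_div_two, pow_succ]
    have h2 : (n ||| 2 ^ (i + 1)) % 2 = 1 ↔ n % 2 = 1 := by simp [pow_succ]
    rw [← ih (by rwa [← Nat.testBit_add_one])] at h1
    rw [pow_succ] at *
    omega

theorem Nat.exists_eq_add_two_pow {n i : ℕ} (h : n.testBit i = true) :
    ∃ m, n = m + 2 ^ i ∧ m.testBit i = false := by
  refine ⟨n ^^^ 2 ^ i, ?_, by simp [h]⟩
  rw [Nat.add_two_pow_eq_lor (by simp [h])]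
  apply Nat.eq_of_testBit_eq
  intro j
  by_cases hj : i = j
  · subst hj; simp [h]
  · simp [hj]

theorem symm_add_two_pow {c d : ℕ ≃ ℕ}
    (hd : ∀ n i : ℕ, Nat.testBit (d n) i = Nat.testBit n (c.symm i)) {x w : ℕ}
    (h : x.testBit w = false) : d.symm (x + 2 ^ w) = d.symm x + 2 ^ c.symm w := by
  have h' : (d.symm x).testBit (c.symm w) = false := by simpa [← hd] using h
  rw [Equiv.symm_apply_eq, Nat.add_two_pow_eq_lor h, Nat.add_two_pow_eq_lor h']
  apply Nat.eq_of_testBit_eq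
  intro j
  simp [hd, ← hd (d.symm x), Nat.testBit_two_pow]

theorem map_zero_of_testBit {c d : ℕ ≃ ℕ}
    (hd : ∀ n i : ℕ, Nat.testBit (d n) i = Nat.testBit n (c.symm i)) : d 0 = 0 :=
  Nat.eq_of_testBit_eq fun j => by simp [hd]

theorem symm_mod_two_pow {c d : ℕ ≃ ℕ}
    (hd : ∀ n i : ℕ, Nat.testBit (d n) i = Nat.testBit n (c.symm i)) (x k : ℕ) :
    d.symm (x % 2 ^ k) =
      ∑ u ∈ Finset.range k, if x.testBit u = true then 2 ^ c.symm u else 0 := by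
  induction k with
  | zero => simp [Nat.mod_one, Equiv.symm_apply_eq, map_zero_of_testBit hd]
  | succ k ih =>
    rw [Finset.sum_range_succ, ← ih, Nat.mod_pow_succ, ← Nat.toNat_testBit]
    cases h : x.testBit k
    · simp
    · simpa using symm_add_two_pow hd (x := x % 2 ^ k) (w := k) (by simp [Nat.testBit_mod_two_pow])

theorem symm_eq_sum {c d : ℕ ≃ ℕ}
    (hd : ∀ n i : ℕ, Nat.testBit (d n) i = Nat.testBit n (c.symm i)) (x : ℕ) :
    d.symm x = ∑ u ∈ Finset.range x, if x.testBit u = true then 2 ^ c.symm u else 0 := by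
  rw [← symm_mod_two_pow hd, Nat.mod_eq_of_lt Nat.lt_two_pow_self]

/-- One carry in the addition of `2 ^ w` to `x`, where `s` gives the next bit position. -/
def carryStep (s : ℕ → ℕ) (p : ℕ × ℕ) : ℕ × ℕ :=
  if p.1.testBit p.2 = true then (p.1 - 2 ^ p.2, s p.2) else p

theorem primrec_carryStep {s : ℕ → ℕ} (hs : Primrec s) : Primrec (carryStep s) :=
  Primrec.ite primrecPred_testBit
    (Primrec.pair (Primrec.nat_sub.comp Primrec.fst
      (primrec₂_pow.comp (Primrec.const 2) Primrec.snd)) (hs.comp Primrec.snd)) Primrec.id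

theorem carryStep_invariant {c d : ℕ ≃ ℕ}
    (hd : ∀ n i : ℕ, Nat.testBit (d n) i = Nat.testBit n (c.symm i)) (p : ℕ × ℕ) :
    d.symm (carryStep (fun x => c (c.symm x + 1)) p).1 +
        2 ^ c.symm (carryStep (fun x => c (c.symm x + 1)) p).2 =
      d.symm p.1 + 2 ^ c.symm p.2 := by
  rcases p with ⟨x, w⟩
  unfold carryStep
  split_ifs with h
  · obtain ⟨m, hx, hm⟩ := Nat.exists_eq_add_two_pow h
    dsimp only at hx hm
    subst hx
    simp [symm_add_two_pow hd hm, pow_succ]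
    ring
  · rfl

theorem carryStep_iterate {c d : ℕ ≃ ℕ}
    (hd : ∀ n i : ℕ, Nat.testBit (d n) i = Nat.testBit n (c.symm i)) (n : ℕ) (p : ℕ × ℕ)
    (hp : p.1 ≤ n) :
    ((carryStep fun x => c (c.symm x + 1))^[n] p).1 +
        2 ^ ((carryStep fun x => c (c.symm x + 1))^[n] p).2 =
      d (d.symm p.1 + 2 ^ c.symm p.2) := by
  by_cases h : p.1.testBit p.2 = true
  · induction n generalizing p with
    | zero => simp [Nat.le_zero.1 hp] at h
    | succ n ih =>
      rw [Function.iterate_succ_apply, ← carryStep_invariant hd p]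
      set q := carryStep (fun x => c (c.symm x + 1)) p with hq
      have hqn : q.1 ≤ n := by
        have := Nat.two_pow_pos p.2
        simp only [hq, carryStep, h, if_true]
        omega
      by_cases h' : q.1.testBit q.2 = true
      · exact ih q hqn h'
      · rw [Function.iterate_fixed (by simp [carryStep, h']), ← Equiv.symm_apply_eq]
        exact symm_add_two_pow hd (by simpa using h')
  · rw [Function.iterate_fixed (by simp [carryStep, h]), ← Equiv.symm_apply_eq]
    exact symm_add_two_pow hd (by simpa using h)

theorem primrec₂_add_two_pow {c d : ℕ ≃ ℕ} (hS : Primrec fun x => c (c.symm x + 1))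
    (hd : ∀ n i : ℕ, Nat.testBit (d n) i = Nat.testBit n (c.symm i)) :
    Primrec₂ (fun x w : ℕ => d (d.symm x + 2 ^ c.symm w)) := by
  have h : Primrec fun p : ℕ × ℕ => (carryStep fun x => c (c.symm x + 1))^[p.1] p :=
    Primrec.nat_iterate Primrec.fst Primrec.id ((primrec_carryStep hS).comp Primrec.snd).to₂
  exact (Primrec.nat_add.comp (Primrec.fst.comp h) (primrec₂_pow.comp (Primrec.const 2)
    (Primrec.snd.comp h))).of_eq fun p => carryStep_iterate hd p.1 p le_rfl

theorem primrec_add_sum {α : Type*} [Primcodable α] (d : ℕ ≃ ℕ) {t : α → ℕ → ℕ}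
    (ht : Primrec fun q : α × ℕ × ℕ => d (d.symm q.2.2 + t q.1 q.2.1)) :
    Primrec fun q : α × ℕ × ℕ =>
      d (d.symm q.2.2 + ∑ u ∈ Finset.range q.2.1, t q.1 u) := by
  have h := Primrec.nat_rec' (f := fun q : α × ℕ × ℕ => q.2.1) (g := fun q => q.2.2)
    (h := fun q p => d (d.symm p.2 + t q.1 p.1))
    (Primrec.fst.comp Primrec.snd) (Primrec.snd.comp Primrec.snd)
    (ht.comp (Primrec.pair (Primrec.fst.comp Primrec.fst) Primrec.snd))
  refine h.of_eq ?_
  rintro ⟨a, k, z⟩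
  dsimp only
  induction k with
  | zero => simp
  | succ k ih => simp [ih, Finset.sum_range_succ, add_assoc]

theorem stmt_12 (c d : ℕ ≃ ℕ)
    (hS : Primrec fun x => c (c.symm x + 1))
    (hadd : Primrec₂ (fun x y : ℕ => c (c.symm x + c.symm y)))
    (hd : ∀ n i : ℕ, Nat.testBit (d n) i = Nat.testBit n (c.symm i)) :
    Primrec₂ (fun x y : ℕ => d (d.symm x * d.symm y)) := by
  let t : (ℕ × ℕ) × ℕ → ℕ → ℕ := fun a v =>
    if a.1.1.testBit a.2 = true ∧ a.1.2.testBit v = true then 2 ^ (c.symm a.2 + c.symm v) else 0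
  have ht : Primrec fun q : ((ℕ × ℕ) × ℕ) × ℕ × ℕ => d (d.symm q.2.2 + t q.1 q.2.1) := by
    have hx : Primrec fun q : ((ℕ × ℕ) × ℕ) × ℕ × ℕ => q.1.1.1 :=
      Primrec.fst.comp (Primrec.fst.comp Primrec.fst)
    have hy : Primrec fun q : ((ℕ × ℕ) × ℕ) × ℕ × ℕ => q.1.1.2 :=
      Primrec.snd.comp (Primrec.fst.comp Primrec.fst)
    have hu : Primrec fun q : ((ℕ × ℕ) × ℕ) × ℕ × ℕ => q.1.2 := Primrec.snd.comp Primrec.fst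
    have hv : Primrec fun q : ((ℕ × ℕ) × ℕ) × ℕ × ℕ => q.2.1 := Primrec.fst.comp Primrec.snd
    have hz : Primrec fun q : ((ℕ × ℕ) × ℕ) × ℕ × ℕ => q.2.2 := Primrec.snd.comp Primrec.snd
    refine (Primrec.ite ((primrecPred_testBit.comp (hx.pair hu)).and
      (primrecPred_testBit.comp (hy.pair hv)))
      ((primrec₂_add_two_pow hS hd).comp hz (hadd.comp hu hv)) hz).of_eq fun q => ?_
    dsimp only [t]
    split_ifs <;> simp
  have hrow : Primrec fun q : (ℕ × ℕ) × ℕ × ℕ =>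
      d (d.symm q.2.2 + ∑ v ∈ Finset.range q.1.2, t (q.1, q.2.1) v) :=
    (primrec_add_sum d ht).comp ((Primrec.fst.pair (Primrec.fst.comp Primrec.snd)).pair
      ((Primrec.snd.comp Primrec.fst).pair (Primrec.snd.comp Primrec.snd)))
  refine ((primrec_add_sum d (t := fun a u => ∑ v ∈ Finset.range a.2, t (a, u) v) hrow).comp
    (Primrec.id.pair (Primrec.fst.pair (Primrec.const 0)))).of_eq ?_
  rintro ⟨x, y⟩
  have h0 : d.symm 0 = 0 := by rw [Equiv.symm_apply_eq, map_zero_of_testBit hd]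
  simp only [id, h0, zero_add]
  rw [symm_eq_sum hd x, symm_eq_sum hd y, Finset.sum_mul_sum]
  congr 1
  refine Finset.sum_congr rfl fun u _ => Finset.sum_congr rfl fun v _ => ?_
  simp only [t, pow_add, ite_and]
  split_ifs <;> simp
end

section
/- Let c : ℕ ≃ ℕ be a bijection with c ∘ S ∘ c⁻¹ primitive recursive (where S x = x + 1) and such that the binary function (x, y) ↦ c (c⁻¹ x + c⁻¹ y) is primitive recursive, and let d : ℕ ≃ ℕ be a bijection satisfying: for all n, i ∈ ℕ, the i-th binary bit of d n equals the (c⁻¹ i)-th binary bit of n. Then the function x ↦ d (2 ^ (d⁻¹ x)) is primitive recursive if and only if the function x ↦ c (2 ^ (c⁻¹ x)) is primitive recursive. -/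
theorem Primrec.natPow : Primrec₂ ((· ^ ·) : ℕ → ℕ → ℕ) :=
  Primrec₂.unpaired'.1 Nat.Primrec.pow

theorem Primrec.of_two_pow {α : Type*} [Primcodable α] {f : α → ℕ}
    (h : Primrec fun a => 2 ^ f a) : Primrec f := by
  have hrel : PrimrecRel fun (a : α) (k : ℕ) => 2 ^ k ≤ 2 ^ f a :=
    Primrec.nat_le.comp (Primrec.natPow.comp (Primrec.const 2) Primrec.snd) (h.comp Primrec.fst)
  refine (Primrec.nat_findGreatest h hrel).of_eq fun a => ?_
  rw [Nat.findGreatest_eq_iff]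
  refine ⟨Nat.lt_two_pow_self.le, fun _ => le_rfl, fun n hn _ hle => ?_⟩
  exact absurd ((Nat.pow_le_pow_iff_right one_lt_two).1 hle) (not_le.2 hn)

theorem PrimrecRel.natTestBit : PrimrecRel fun x i : ℕ => Nat.testBit x i = true := by
  have h : PrimrecRel fun x i : ℕ => x / 2 ^ i % 2 = 1 :=
    Primrec.eq.comp
      (Primrec.nat_mod.comp
        (Primrec.nat_div.comp Primrec.fst
          (Primrec.natPow.comp (Primrec.const 2) Primrec.snd))
        (Primrec.const 2))
      (Primrec.const 1)
  exact PrimrecPred.of_eq h fun p => by simp [Nat.testBit_eq_decide_div_mod_eq]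

theorem Nat.two_pow_add_eq_or_of_testBit_eq_false {x n : ℕ} (h : Nat.testBit x n = false) :
    2 ^ n + x = 2 ^ n ||| x := by
  refine Nat.eq_of_testBit_eq fun i => ?_
  rw [Nat.testBit_or, Nat.testBit_two_pow]
  rcases lt_trichotomy i n with hi | rfl | hi
  · simp [Nat.testBit_two_pow_add_gt hi, hi.ne']
  · simp [Nat.testBit_two_pow_add_eq, h]
  · obtain ⟨k, rfl⟩ := Nat.exists_eq_add_of_lt hi
    have hdiv : (2 ^ n + x) / 2 ^ (n + 1) = x / 2 ^ (n + 1) := by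
      rw [Nat.testBit_eq_decide_div_mod_eq, decide_eq_false_iff_not] at h
      rw [pow_succ, ← Nat.div_div_eq_div_mul, ← Nat.div_div_eq_div_mul,
        Nat.add_div_left _ (Nat.two_pow_pos n)]
      omega
    have hshift (y : ℕ) : y.testBit (n + k + 1) = (y / 2 ^ (n + 1)).testBit k := by
      rw [Nat.testBit_div_two_pow]
      congr 1
      omega
    rw [hshift, hdiv, ← hshift]
    simp [hi.ne]

theorem testBit_symm_of_bitPermutation {c d : ℕ ≃ ℕ}
    (hd : ∀ n i : ℕ, Nat.testBit (d n) i = Nat.testBit n (c.symm i))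
    (m j : ℕ) :
    Nat.testBit (d.symm m) j = Nat.testBit m (c j) := by
  simpa using (hd (d.symm m) (c j)).symm

theorem bitPermutation_two_pow {c d : ℕ ≃ ℕ}
    (hd : ∀ n i : ℕ, Nat.testBit (d n) i = Nat.testBit n (c.symm i))
    (y : ℕ) : d (2 ^ y) = 2 ^ c y := by
  refine Nat.eq_of_testBit_eq fun i => ?_
  rw [hd, Nat.testBit_two_pow, Nat.testBit_two_pow]
  simp [Equiv.eq_symm_apply]

theorem bitPermutation_symm_two_pow {c d : ℕ ≃ ℕ}
    (hd : ∀ n i : ℕ, Nat.testBit (d n) i = Nat.testBit n (c.symm i))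
    (i : ℕ) : d.symm (2 ^ i) = 2 ^ c.symm i := by
  rw [Equiv.symm_apply_eq, bitPermutation_two_pow hd, Equiv.apply_symm_apply]

theorem bitPermutation_symm_zero {c d : ℕ ≃ ℕ}
    (hd : ∀ n i : ℕ, Nat.testBit (d n) i = Nat.testBit n (c.symm i)) :
    d.symm 0 = 0 := by
  refine Nat.eq_of_testBit_eq fun i => ?_
  simp [testBit_symm_of_bitPermutation hd]

theorem bitPermutation_symm_two_pow_add {c d : ℕ ≃ ℕ}
    (hd : ∀ n i : ℕ, Nat.testBit (d n) i = Nat.testBit n (c.symm i))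
    {x n : ℕ} (h : Nat.testBit x n = false) :
    d.symm (2 ^ n + x) = 2 ^ c.symm n + d.symm x := by
  rw [Nat.two_pow_add_eq_or_of_testBit_eq_false h,
    Nat.two_pow_add_eq_or_of_testBit_eq_false
      (by rw [testBit_symm_of_bitPermutation hd, Equiv.apply_symm_apply, h])]
  refine Nat.eq_of_testBit_eq fun i => ?_
  simp only [testBit_symm_of_bitPermutation hd, Nat.testBit_or,
    ← bitPermutation_symm_two_pow hd]

theorem bitPermutation_symm_mod_two_pow_succ {c d : ℕ ≃ ℕ}
    (hd : ∀ n i : ℕ, Nat.testBit (d n) i = Nat.testBit n (c.symm i))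
    (x n : ℕ) :
    d.symm (x % 2 ^ (n + 1)) =
      if Nat.testBit x n = true then 2 ^ c.symm n + d.symm (x % 2 ^ n)
      else d.symm (x % 2 ^ n) := by
  have hmod : x % 2 ^ (n + 1) = 2 ^ n * (x.testBit n).toNat + x % 2 ^ n := by
    rw [Nat.mod_pow_succ, Nat.toNat_testBit, add_comm]
  rw [hmod]
  split_ifs with h
  · simpa [h] using bitPermutation_symm_two_pow_add hd (x := x % 2 ^ n) (n := n) (by simp)
  · simp [h]

theorem primrec_comp_bitPermutation_symm {c d : ℕ ≃ ℕ}
    (hd : ∀ n i : ℕ, Nat.testBit (d n) i = Nat.testBit n (c.symm i))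
    (hadd : Primrec₂ (fun x y : ℕ => c (c.symm x + c.symm y)))
    (hpow : Primrec fun x => c (2 ^ (c.symm x))) : Primrec fun x => c (d.symm x) := by
  let step : ℕ → ℕ × ℕ → ℕ := fun x p =>
    if Nat.testBit x p.1 = true then c (c.symm (c (2 ^ c.symm p.1)) + c.symm p.2) else p.2
  have hstep : Primrec₂ step :=
    Primrec.ite
      (PrimrecRel.natTestBit.comp Primrec.fst (Primrec.fst.comp Primrec.snd))
      (hadd.comp (hpow.comp (Primrec.fst.comp Primrec.snd)) (Primrec.snd.comp Primrec.snd))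
      (Primrec.snd.comp Primrec.snd)
  have hrec : ∀ x n : ℕ,
      (Nat.rec (c 0) (fun k r => step x (k, r)) n : ℕ) = c (d.symm (x % 2 ^ n)) := by
    intro x n
    induction n with
    | zero => simp [Nat.mod_one, bitPermutation_symm_zero hd]
    | succ n ih =>
      refine (congrArg (fun r => step x (n, r)) ih).trans ?_
      rw [bitPermutation_symm_mod_two_pow_succ hd]
      simp only [step, Equiv.symm_apply_apply]
      split_ifs <;> rfl
  refine (Primrec.nat_rec' Primrec.id (Primrec.const (c 0)) hstep).of_eq fun x => ?_
  exact (hrec x x).trans (by rw [Nat.mod_eq_of_lt Nat.lt_two_pow_self])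

theorem stmt_13 (c d : ℕ ≃ ℕ)
    (hS : Primrec fun x => c (c.symm x + 1))
    (hadd : Primrec₂ (fun x y : ℕ => c (c.symm x + c.symm y)))
    (hd : ∀ n i : ℕ, Nat.testBit (d n) i = Nat.testBit n (c.symm i)) :
    Primrec (fun x => d (2 ^ (d.symm x))) ↔ Primrec (fun x => c (2 ^ (c.symm x))) := by
  simp only [bitPermutation_two_pow hd]
  constructor
  · intro h
    refine ((Primrec.of_two_pow h).comp
      (Primrec.natPow.comp (Primrec.const 2) Primrec.id)).of_eq fun i => ?_
    simp [bitPermutation_symm_two_pow hd]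
  · intro h
    exact Primrec.natPow.comp (Primrec.const 2) (primrec_comp_bitPermutation_symm hd hadd h)
end

section
/- There exists a bijection c : ℕ ≃ ℕ such that c ∘ S ∘ c⁻¹ is primitive recursive (where S x = x + 1), the conjugate c ∘ (x ↦ 2·x) ∘ c⁻¹ of the doubling function is primitive recursive, and for every primitive recursive function f : ℕ → ℕ satisfying x² ≤ f x for all sufficiently large x, the conjugate c ∘ f ∘ c⁻¹ is not primitive recursive. -/
open Nat.Partrec (Code)

/-- A computable function is bounded, at `s`, by every time at which some primitive recursive
clock started at `s` has run out. -/
theorem exists_primrec_clock {h : ℕ → ℕ} (hh : Computable h) :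
    ∃ P : ℕ → ℕ → Bool, Primrec₂ P ∧ (∀ s t, P s t = true → s < t ∧ h s < t) ∧
      ∀ s, ∃ t, P s t = true := by
  obtain ⟨c, hc⟩ := Code.exists_code.1 (Partrec.nat_iff.1 hh)
  have hmem : ∀ s a, a ∈ Code.eval c s ↔ a = h s := by simp [hc]
  refine ⟨fun s t => Option.casesOn (Code.evaln t c s) false fun a => decide (a < t), ?_, ?_, ?_⟩
  · refine Primrec.option_casesOn (o := fun p : ℕ × ℕ => Code.evaln p.2 c p.1)
      (f := fun _ => false) (g := fun p a => decide (a < p.2)) ?_ (Primrec.const false) ?_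
    · exact Code.primrec_evaln.comp
        ((Primrec.snd.pair (Primrec.const c)).pair Primrec.fst)
    · exact (Primrec.nat_lt.comp Primrec.snd (Primrec.snd.comp Primrec.fst)).decide
  · intro s t hP
    rcases e : Code.evaln t c s with _ | a
    · simp [e] at hP
    · simp only [e, decide_eq_true_eq] at hP
      have ha : a ∈ Code.evaln t c s := e
      exact ⟨Code.evaln_bound ha, (hmem s a).1 (Code.evaln_sound ha) ▸ hP⟩
  · intro s
    obtain ⟨k, hk⟩ := Code.evaln_complete.1 ((hmem s (h s)).2 rfl)
    have hk' := Code.evaln_mono (le_max_left k (h s + 1)) hk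
    refine ⟨max k (h s + 1), ?_⟩
    simp [Option.mem_def.1 hk']

/-! ### Blocks of stages -/

/-- The first stage of the block containing the stage `t`. -/
def blockStart (P : ℕ → ℕ → Bool) : ℕ → ℕ :=
  Nat.rec 0 fun t s => bif P s t then t + 1 else s

/-- The stage `t` is the last one of the block that starts at `s`. -/
def IsBlock (P : ℕ → ℕ → Bool) (s t : ℕ) : Prop :=
  P s t = true ∧ blockStart P t = s

instance (P : ℕ → ℕ → Bool) : DecidableRel (IsBlock P) :=
  fun _ _ => inferInstanceAs (Decidable (_ ∧ _))

section Blocks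

variable {P : ℕ → ℕ → Bool}

theorem blockStart_succ (t : ℕ) :
    blockStart P (t + 1) = if P (blockStart P t) t = true then t + 1 else blockStart P t := by
  change (bif P (blockStart P t) t then t + 1 else blockStart P t) = _
  rw [Bool.cond_eq_ite]

theorem blockStart_le (t : ℕ) : blockStart P t ≤ t := by
  induction t with
  | zero => exact le_rfl
  | succ t ih => rw [blockStart_succ]; split_ifs <;> omega

theorem blockStart_blockStart (t : ℕ) : blockStart P (blockStart P t) = blockStart P t := by
  induction t with
  | zero => rfl
  | succ t ih =>
    rw [blockStart_succ]
    split_ifs with h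
    · rw [blockStart_succ, if_pos h]
    · exact ih

theorem IsBlock.lt_blockStart {s t u : ℕ} (h : IsBlock P s t) (htu : t < u) :
    t < blockStart P u := by
  induction u, htu using Nat.le_induction with
  | base => rw [blockStart_succ, if_pos (h.2.symm ▸ h.1)]; omega
  | succ u hu ih => rw [blockStart_succ]; split_ifs <;> omega

theorem IsBlock.unique {s t u : ℕ} (ht : IsBlock P s t) (hu : IsBlock P s u) : t = u := by
  have h1 := ht.2 ▸ blockStart_le (P := P) t
  have h2 := hu.2 ▸ blockStart_le (P := P) u
  rcases lt_trichotomy t u with h | h | h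
  · have := hu.2 ▸ ht.lt_blockStart h
    omega
  · exact h
  · have := ht.2 ▸ hu.lt_blockStart h
    omega

theorem exists_isBlock (hlt : ∀ s t, P s t = true → s < t) (hex : ∀ s, ∃ t, P s t = true)
    {s : ℕ} (hs : blockStart P s = s) : ∃ t, IsBlock P s t := by
  have hstart : ∀ u, s ≤ u → u ≤ Nat.find (hex s) → blockStart P u = s := by
    intro u hu
    induction u, hu using Nat.le_induction with
    | base => exact fun _ => hs
    | succ u hu ih =>
      intro h
      rw [blockStart_succ, ih (by omega), if_neg (Nat.find_min (hex s) (by omega))]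
  have hspec := Nat.find_spec (hex s)
  exact ⟨_, hspec, hstart _ (hlt _ _ hspec).le le_rfl⟩

theorem exists_isBlock_ge (hlt : ∀ s t, P s t = true → s < t) (hex : ∀ s, ∃ t, P s t = true)
    (N : ℕ) : ∃ s t, N ≤ s ∧ IsBlock P s t := by
  obtain ⟨t, ht⟩ := exists_isBlock hlt hex (blockStart_blockStart N)
  have htN : N ≤ t := by
    by_contra! h
    have h1 := ht.lt_blockStart h
    have h2 := blockStart_le (P := P) t
    rw [ht.2] at h2
    omega
  have hs : blockStart P (t + 1) = t + 1 := by
    rw [blockStart_succ, if_pos (ht.2.symm ▸ ht.1)]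
  obtain ⟨u, hu⟩ := exists_isBlock hlt hex hs
  exact ⟨t + 1, u, by omega, hu⟩

theorem primrec_blockStart (hP : Primrec₂ P) : Primrec (blockStart P) := by
  refine Primrec.nat_rec₁ 0 ?_
  exact Primrec.cond (hP.comp Primrec.snd Primrec.fst) (Primrec.succ.comp Primrec.fst) Primrec.snd

theorem primrecRel_isBlock (hP : Primrec₂ P) : PrimrecRel (IsBlock P) := by
  refine PrimrecPred.and (Primrec.primrecPred ?_) ?_
  · exact Primrec.of_eq hP fun p => Bool.decide_eq_true.symm
  · exact Primrec.eq.comp ((primrec_blockStart hP).comp Primrec.snd) Primrec.fst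

end Blocks

/-! ### Labelling the natural numbers -/

/-- The value of `2 ^ m * x + k` at the number `x = 2 ^ (t + 1) ^ 2` that is chosen at stage `t`. -/
def blockValue (t m k : ℕ) : ℕ := 2 ^ ((t + 1) ^ 2 + m) + k

/-- The label of `2 ^ m * x + k` is `(s, m, k)` if the block starting at `s` ends at a stage `t`
greater than `m` and `k`, and `x` is chosen at stage `t`; all other numbers label themselves. -/
def label (P : ℕ → ℕ → Bool) (n : ℕ) : ℕ ⊕ ℕ × ℕ × ℕ :=
  let t := (Nat.log 2 n).sqrt - 1
  let m := Nat.log 2 n - (t + 1) ^ 2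
  let k := n - 2 ^ Nat.log 2 n
  if IsBlock P (blockStart P t) t ∧ m < t ∧ k < t then Sum.inr (blockStart P t, m, k)
  else Sum.inl n

theorem lt_two_pow_sq_add (t m : ℕ) : t < 2 ^ ((t + 1) ^ 2 + m) :=
  Nat.lt_two_pow_self.trans_le (Nat.pow_le_pow_right two_pos (by nlinarith))

theorem blockValue_lt {t m k : ℕ} (hm : m < t) (hk : k < t) :
    blockValue t m k < (2 ^ (t + 1) ^ 2) ^ 2 := by
  have h1 := lt_two_pow_sq_add t m
  calc blockValue t m k < 2 ^ ((t + 1) ^ 2 + m) + 2 ^ ((t + 1) ^ 2 + m) := by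
        unfold blockValue; omega
    _ = 2 ^ ((t + 1) ^ 2 + m + 1) := by ring
    _ ≤ 2 ^ ((t + 1) ^ 2 * 2) := Nat.pow_le_pow_right two_pos (by nlinarith)
    _ = _ := pow_mul _ _ _

section Label

variable {P : ℕ → ℕ → Bool}

theorem label_blockValue {s t m k : ℕ} (h : IsBlock P s t) (hm : m < t) (hk : k < t) :
    label P (blockValue t m k) = Sum.inr (s, m, k) := by
  have hlog : Nat.log 2 (blockValue t m k) = (t + 1) ^ 2 + m := by
    have := lt_two_pow_sq_add t m
    apply Nat.log_eq_of_pow_le_of_lt_pow <;> unfold blockValue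
    · omega
    · rw [pow_succ 2 (_ + m)]; omega
  have hsqrt : ((t + 1) ^ 2 + m).sqrt = t + 1 := by
    rw [sq]; exact Nat.sqrt_add_eq _ (by omega)
  have hk' : blockValue t m k - 2 ^ ((t + 1) ^ 2 + m) = k := by simp [blockValue]
  simp only [label, hlog, hsqrt, hk', Nat.add_sub_cancel, Nat.add_sub_cancel_left, h.2]
  rw [if_pos ⟨h, hm, hk⟩]

theorem label_eq_inl_or (n : ℕ) : label P n = Sum.inl n ∨
    ∃ s t m k, IsBlock P s t ∧ m < t ∧ k < t ∧ n = blockValue t m k ∧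
      label P n = Sum.inr (s, m, k) := by
  unfold label
  extract_lets t m k
  split_ifs with h
  · refine Or.inr ⟨_, t, m, k, h.1, h.2.1, h.2.2, ?_, rfl⟩
    have hsqrt : 0 < (Nat.log 2 n).sqrt := by omega
    have ht : t + 1 = (Nat.log 2 n).sqrt := by omega
    have hle : (t + 1) ^ 2 ≤ Nat.log 2 n := by rw [ht]; exact Nat.sqrt_le' _
    have hn : n ≠ 0 := by rintro rfl; simp at hsqrt
    have := Nat.pow_log_le_self 2 hn
    simp only [blockValue, m, k, Nat.add_sub_cancel' hle]
    omega
  · exact Or.inl rfl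

theorem label_injective : Function.Injective (label P) := by
  intro a b hab
  rcases label_eq_inl_or (P := P) a with ha | ⟨s, t, m, k, h, hm, hk, rfl, ha⟩ <;>
  rcases label_eq_inl_or (P := P) b with hb | ⟨s', t', m', k', h', hm', hk', rfl, hb⟩ <;>
  rw [ha, hb] at hab
  · exact Sum.inl.inj hab
  · cases hab
  · cases hab
  · cases hab
    rw [h.unique h']

theorem primrec_two_pow : Primrec fun n : ℕ => 2 ^ n :=
  (Primrec₂.unpaired'.1 Nat.Primrec.pow).comp (Primrec.const 2) Primrec.id

theorem primrec_log_two : Primrec (Nat.log 2) := by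
  refine (Primrec.nat_findGreatest (f := fun n => n) (p := fun n k => 2 ^ k ≤ n) Primrec.id
    (Primrec.nat_le.comp (primrec_two_pow.comp Primrec.snd) Primrec.fst)).of_eq fun n => ?_
  rcases eq_or_ne n 0 with rfl | hn
  · simp
  · rw [Nat.findGreatest_eq_iff]
    refine ⟨Nat.log_le_self 2 n, fun _ => Nat.pow_log_le_self 2 hn, fun k hk _ => ?_⟩
    rw [not_le]
    exact Nat.lt_pow_of_log_lt one_lt_two hk

theorem primrec_add_one_sq : Primrec fun t : ℕ => (t + 1) ^ 2 :=
  (Primrec.nat_mul.comp Primrec.succ Primrec.succ).of_eq fun t => (sq (t + 1)).symm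

theorem primrec_blockValue :
    Primrec fun p : ℕ × ℕ × ℕ => blockValue p.1 p.2.1 p.2.2 :=
  Primrec.nat_add.comp
    (primrec_two_pow.comp (Primrec.nat_add.comp (primrec_add_one_sq.comp Primrec.fst)
      (Primrec.fst.comp Primrec.snd)))
    (Primrec.snd.comp Primrec.snd)

theorem primrec_label (hP : Primrec₂ P) : Primrec (label P) := by
  have ht : Primrec fun n => (Nat.log 2 n).sqrt - 1 :=
    Primrec.pred.comp (Primrec.nat_sqrt.comp primrec_log_two)
  have hm : Primrec fun n => Nat.log 2 n - ((Nat.log 2 n).sqrt - 1 + 1) ^ 2 :=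
    Primrec.nat_sub.comp primrec_log_two (primrec_add_one_sq.comp ht)
  have hk : Primrec fun n => n - 2 ^ Nat.log 2 n :=
    Primrec.nat_sub.comp Primrec.id (primrec_two_pow.comp primrec_log_two)
  have hs := (primrec_blockStart hP).comp ht
  exact Primrec.ite (((primrecRel_isBlock hP).comp hs ht).and
      ((Primrec.nat_lt.comp hm ht).and (Primrec.nat_lt.comp hk ht)))
    (Primrec.sumInr.comp (hs.pair (hm.pair hk))) Primrec.sumInl

theorem primrec_findGreatest_isBlock (hP : Primrec₂ P) :
    Primrec₂ fun s b => Nat.findGreatest (IsBlock P s) b :=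
  Primrec.nat_findGreatest (p := fun (q : ℕ × ℕ) t => IsBlock P q.1 t) Primrec.snd
    ((primrecRel_isBlock hP).comp (Primrec.fst.comp Primrec.fst) Primrec.snd)

theorem isBlock_findGreatest_iff {s t : ℕ} (h : IsBlock P s t) (b : ℕ) :
    IsBlock P s (Nat.findGreatest (IsBlock P s) b) ↔ t ≤ b :=
  ⟨fun hb => h.unique hb ▸ Nat.findGreatest_le b, fun hb => Nat.findGreatest_spec hb h⟩

theorem primrecPred_mem_range_label (hP : Primrec₂ P) (hlt : ∀ s t, P s t = true → s < t)
    (hex : ∀ s, ∃ t, P s t = true) : PrimrecPred (· ∈ Set.range (label P)) := by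
  let g : ℕ × ℕ × ℕ → Bool := fun q =>
    decide (blockStart P q.1 = q.1 ∧
      ¬ IsBlock P q.1 (Nat.findGreatest (IsBlock P q.1) (max q.2.1 q.2.2)))
  have hg : Primrec g := by
    refine PrimrecPred.decide (PrimrecPred.and ?_ (PrimrecPred.not ?_))
    · exact Primrec.eq.comp ((primrec_blockStart hP).comp Primrec.fst) Primrec.fst
    · exact (primrecRel_isBlock hP).comp Primrec.fst
        ((primrec_findGreatest_isBlock hP).comp Primrec.fst
          (Primrec.nat_max.comp (Primrec.fst.comp Primrec.snd) (Primrec.snd.comp Primrec.snd)))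
  have hf : Primrec fun n => decide (label P n = Sum.inl n) :=
    (Primrec.eq.comp (primrec_label hP) Primrec.sumInl).decide
  have hfg : Primrec fun a : ℕ ⊕ ℕ × ℕ × ℕ =>
      Sum.casesOn (motive := fun _ => Bool) a (fun n => decide (label P n = Sum.inl n)) g :=
    Primrec.sumCasesOn Primrec.id (hf.comp Primrec.snd).to₂ (hg.comp Primrec.snd).to₂
  classical
  refine Primrec.primrecPred (hfg.of_eq fun a => ?_)
  rw [Bool.eq_iff_iff, decide_eq_true_iff]
  rcases a with n | ⟨s, m, k⟩
  · simp only [decide_eq_true_eq, Set.mem_range]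
    refine ⟨fun h => ⟨n, h⟩, fun ⟨y, hy⟩ => ?_⟩
    rcases label_eq_inl_or (P := P) y with h | ⟨_, _, _, _, _, _, _, _, h⟩
    · cases h.symm.trans hy
      exact h
    · cases h.symm.trans hy
  · simp only [g, decide_eq_true_eq, Set.mem_range]
    constructor
    · rintro ⟨hs, hb⟩
      obtain ⟨t, ht⟩ := exists_isBlock hlt hex hs
      rw [isBlock_findGreatest_iff ht] at hb
      exact ⟨_, label_blockValue ht (by omega) (by omega)⟩
    · rintro ⟨y, hy⟩
      rcases label_eq_inl_or (P := P) y with h | ⟨_, t, _, _, ht, hm, hk, _, h⟩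
      · cases h.symm.trans hy
      · cases h.symm.trans hy
        rw [isBlock_findGreatest_iff ht]
        exact ⟨ht.2 ▸ blockStart_blockStart t, by omega⟩

/-- A map acting on the numbers `2 ^ m * x + k` uniformly in `x` is primitive recursive
on labels. -/
theorem exists_primrec_label_comp (hP : Primrec₂ P) {φ : ℕ → ℕ} (hφ : Primrec φ)
    {ψ : ℕ × ℕ → ℕ × ℕ} (hψ : Primrec ψ)
    (h : ∀ t m k, φ (blockValue t m k) = blockValue t (ψ (m, k)).1 (ψ (m, k)).2) :
    ∃ F : ℕ ⊕ ℕ × ℕ × ℕ → ℕ ⊕ ℕ × ℕ × ℕ, Primrec F ∧ ∀ n, F (label P n) = label P (φ n) := by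
  let e : ℕ × ℕ × ℕ → ℕ := fun q =>
    Nat.findGreatest (IsBlock P q.1) (max (ψ q.2).1 (ψ q.2).2)
  let g : ℕ × ℕ × ℕ → ℕ ⊕ ℕ × ℕ × ℕ := fun q =>
    if IsBlock P q.1 (e q) then label P (φ (blockValue (e q) q.2.1 q.2.2))
    else Sum.inr (q.1, ψ q.2)
  have hψ' : Primrec fun q : ℕ × ℕ × ℕ => ψ q.2 := hψ.comp Primrec.snd
  have he : Primrec e := (primrec_findGreatest_isBlock hP).comp Primrec.fst
    (Primrec.nat_max.comp (Primrec.fst.comp hψ') (Primrec.snd.comp hψ'))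
  have hg : Primrec g := Primrec.ite ((primrecRel_isBlock hP).comp Primrec.fst he)
    ((primrec_label hP).comp (hφ.comp (primrec_blockValue.comp (he.pair Primrec.snd))))
    (Primrec.sumInr.comp (Primrec.fst.pair hψ'))
  refine ⟨fun a => Sum.casesOn a (fun n => label P (φ n)) g, ?_, fun n => ?_⟩
  · exact Primrec.sumCasesOn Primrec.id
      (((primrec_label hP).comp hφ).comp Primrec.snd).to₂ (hg.comp Primrec.snd).to₂
  · rcases label_eq_inl_or (P := P) n with hn | ⟨s, t, m, k, ht, hm, hk, rfl, hn⟩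
    · rw [hn]
    · rw [hn]
      simp only [g]
      split_ifs with hb
      · rw [← ht.unique hb]
      · simp only [e] at hb
        rw [isBlock_findGreatest_iff ht] at hb
        rw [h, label_blockValue ht (by omega) (by omega)]

theorem lt_sq_of_encode_label_lt {s t y : ℕ} (ht : IsBlock P s t)
    (hy : Encodable.encode (label P y) < t) : y < (2 ^ (t + 1) ^ 2) ^ 2 := by
  have hpow : t < (2 ^ (t + 1) ^ 2) ^ 2 :=
    (lt_two_pow_sq_add t 0).trans_le (Nat.le_self_pow two_ne_zero _)
  rcases label_eq_inl_or (P := P) y with h | ⟨s', u, m, k, hu, hm, hk, rfl, h⟩ <;> rw [h] at hy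
  · have : 2 * y < t := hy
    omega
  · have h1 : 2 * Nat.pair s' (Nat.pair m k) + 1 < t := hy
    have h2 := Nat.left_le_pair s' (Nat.pair m k)
    have hut : u ≤ t := by
      by_contra! htu
      have := ht.lt_blockStart htu
      rw [hu.2] at this
      omega
    refine (blockValue_lt hm hk).trans_le ?_
    gcongr
    norm_num

end Label

/-! ### Primitive recursive enumerations -/

theorem primrec_count {p : ℕ → Prop} [DecidablePred p] (hp : PrimrecPred p) :
    Primrec (Nat.count p) := by
  have hstep : Primrec₂ fun n c : ℕ => c + if p n then 1 else 0 :=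
    Primrec.nat_add.comp Primrec.snd
      (Primrec.ite (hp.comp Primrec.fst) (Primrec.const 1) (Primrec.const 0))
  refine (Primrec.nat_rec₁ 0 hstep).of_eq fun n => ?_
  induction n with
  | zero => simp
  | succ n ih => rw [Nat.count_succ, ← ih]

theorem Nat.nth_le_sum_of_injective {p : ℕ → Prop} {v : ℕ → ℕ} (hv : v.Injective)
    (hp : ∀ n, p (v n)) (n : ℕ) : Nat.nth p n ≤ ∑ i ∈ Finset.range (n + 1), v i := by
  classical
  refine Nat.lt_succ_iff.1 (Nat.nth_lt_of_lt_count ?_)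
  rw [Nat.count_eq_card_filter_range]
  calc n < ((Finset.range (n + 1)).image v).card := by
        rw [Finset.card_image_of_injective _ hv, Finset.card_range]; omega
    _ ≤ _ := by
        refine Finset.card_le_card fun y hy => ?_
        obtain ⟨i, hi, rfl⟩ := Finset.mem_image.1 hy
        simp only [Finset.mem_filter, Finset.mem_range]
        exact ⟨Nat.lt_succ_of_le (Finset.single_le_sum (fun _ _ => Nat.zero_le _) hi), hp i⟩

theorem primrec_nth {p : ℕ → Prop} (hp : PrimrecPred p) {v : ℕ → ℕ} (hv : Primrec v)
    (hinj : v.Injective) (hpv : ∀ n, p (v n)) : Primrec (Nat.nth p) := by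
  classical
  have hinf : (Set.ofPred p).Infinite :=
    Set.infinite_of_injective_forall_mem hinj hpv
  have hsum : Primrec fun n => ∑ i ∈ Finset.range (n + 1), v i := by
    have hstep : Primrec₂ fun n c : ℕ => c + v n :=
      Primrec.nat_add.comp Primrec.snd (hv.comp Primrec.fst)
    have hrec : Primrec fun n => ∑ i ∈ Finset.range n, v i := by
      refine (Primrec.nat_rec₁ 0 hstep).of_eq fun n => ?_
      induction n with
      | zero => simp
      | succ n ih => rw [Finset.sum_range_succ, ← ih]
    exact hrec.comp Primrec.succ
  refine (Primrec.nat_findGreatest (p := fun n y => Nat.count p y ≤ n) hsum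
    (Primrec.nat_le.comp ((primrec_count hp).comp Primrec.snd) Primrec.fst)).of_eq fun n => ?_
  simp only [Nat.count_le_iff_le_nth hinf]
  rw [Nat.findGreatest_eq_iff]
  exact ⟨Nat.nth_le_sum_of_injective hinj hpv n, fun _ => le_rfl, fun _ h _ => not_le.2 h⟩

/-- A primitive recursive injective sequence with primitive recursive range can be renumbered
into a permutation of `ℕ` by maps that are primitive recursive in both directions. -/
theorem exists_equiv_of_primrecPred_range {α : Type*} [Primcodable α] {v : ℕ → α}
    (hv : Primrec v) (hinj : v.Injective) (hr : PrimrecPred (· ∈ Set.range v)) :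
    ∃ (c : ℕ ≃ ℕ) (f : α → ℕ) (g : ℕ → α), Primrec f ∧ Primrec g ∧
      (∀ n, f (v n) = c n) ∧ ∀ n, g (c n) = v n := by
  classical
  let w : ℕ → ℕ := fun n => Encodable.encode (v n)
  let d : ℕ → α := fun y => (Encodable.decode y).getD (v 0)
  have hd : Primrec d := Primrec.option_getD.comp Primrec.decode (Primrec.const (v 0))
  have hdw : ∀ n, d (w n) = v n := fun n => by simp [d, w]
  have hw : Primrec w := Primrec.encode.comp hv
  have hwinj : w.Injective := Encodable.encode_injective.comp hinj
  let p : ℕ → Prop := fun y => y ∈ Set.range w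
  have hpw : ∀ n, p (w n) := Set.mem_range_self
  have hp : PrimrecPred p := by
    refine PrimrecPred.of_eq ((hr.comp hd).and
      (Primrec.eq.comp (Primrec.encode.comp hd) Primrec.id)) fun y => ?_
    constructor
    · rintro ⟨⟨n, hn⟩, hy⟩
      exact ⟨n, by simp only [w, hn]; exact hy⟩
    · rintro ⟨n, rfl⟩
      exact ⟨⟨n, (hdw n).symm⟩, by rw [hdw]; rfl⟩
  have hinf : (Set.ofPred p).Infinite := Set.infinite_of_injective_forall_mem hwinj hpw
  have hbij : Function.Bijective fun n => Nat.count p (w n) := by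
    constructor
    · exact fun a b hab => hwinj (Nat.count_injective (hpw a) (hpw b) hab)
    · intro y
      obtain ⟨n, hn⟩ := Nat.nth_mem_of_infinite hinf y
      exact ⟨n, by simp only [hn]; exact Nat.count_nth_of_infinite hinf y⟩
  refine ⟨Equiv.ofBijective _ hbij, fun a => Nat.count p (Encodable.encode a),
    fun y => d (Nat.nth p y), (primrec_count hp).comp Primrec.encode,
    hd.comp (primrec_nth hp hw hwinj hpw), fun _ => rfl, fun n => ?_⟩
  simp only [Equiv.ofBijective_apply, Nat.nth_count (hpw n), hdw]

theorem stmt_15 : ∃ c : ℕ ≃ ℕ,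
    Primrec (fun x => c (c.symm x + 1)) ∧
    Primrec (fun x => c (2 * c.symm x)) ∧
    ∀ f : ℕ → ℕ, Primrec f → (∀ᶠ x in Filter.atTop, x ^ 2 ≤ f x) →
      ¬ Primrec (fun x => c (f (c.symm x))) := by
  let q : ℕ → ℕ := fun s => Encodable.encode (Sum.inr (s, 0, 0) : ℕ ⊕ ℕ × ℕ × ℕ)
  have hq : Primrec q := Primrec.encode.comp (Primrec.sumInr.comp
    (Primrec.id.pair (Primrec.const (0, 0))))
  obtain ⟨P, hP, hbound, hex⟩ :=
    exists_primrec_clock (computable₂_ack.comp Computable.id hq.to_comp)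
  have hlt : ∀ s t, P s t = true → s < t := fun s t h => (hbound s t h).1
  obtain ⟨c, enc, dec, henc, hdec, hencv, hdecv⟩ := exists_equiv_of_primrecPred_range
    (primrec_label hP) label_injective (primrecPred_mem_range_label hP hlt hex)
  have transfer : ∀ {φ : ℕ → ℕ} {F : ℕ ⊕ ℕ × ℕ × ℕ → ℕ ⊕ ℕ × ℕ × ℕ}, Primrec F →
      (∀ n, F (label P n) = label P (φ n)) → Primrec fun x => c (φ (c.symm x)) := by
    intro φ F hF hFφ
    refine (henc.comp (hF.comp hdec)).of_eq fun x => ?_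
    obtain ⟨n, rfl⟩ := c.surjective x
    rw [hdecv, hFφ, hencv, c.symm_apply_apply]
  refine ⟨c, ?_, ?_, fun f _ hf hcf => ?_⟩
  · obtain ⟨F, hF, hFφ⟩ := exists_primrec_label_comp hP Primrec.succ
      (ψ := fun q => (q.1, q.2 + 1)) (Primrec.fst.pair (Primrec.succ.comp Primrec.snd))
      fun t m k => rfl
    exact transfer hF hFφ
  · obtain ⟨F, hF, hFφ⟩ := exists_primrec_label_comp hP
      (Primrec.nat_mul.comp (Primrec.const 2) Primrec.id)
      (ψ := fun q => (q.1 + 1, 2 * q.2)) ((Primrec.succ.comp Primrec.fst).pair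
        (Primrec.nat_mul.comp (Primrec.const 2) Primrec.snd))
      fun t m k => by simp only [blockValue, id]; ring
    exact transfer hF hFφ
  · obtain ⟨N, hN⟩ := Filter.eventually_atTop.1 hf
    let d : ℕ → ℕ ⊕ ℕ × ℕ × ℕ := fun y => (Encodable.decode y).getD (label P 0)
    have hd : Primrec d := Primrec.option_getD.comp Primrec.decode (Primrec.const _)
    let G : ℕ → ℕ := fun y =>
      Encodable.encode (dec (c (f (c.symm (enc (d y))))))
    have hG : Primrec G :=
      Primrec.encode.comp (hdec.comp (hcf.comp (henc.comp hd)))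
    have hGlabel : ∀ n, G (Encodable.encode (label P n)) = Encodable.encode (label P (f n)) := by
      intro n
      simp only [G, d, Encodable.encodek, Option.getD_some, hencv, c.symm_apply_apply, hdecv]
    obtain ⟨M, hM⟩ := exists_lt_ack_of_nat_primrec (Primrec.nat_iff.1 hG)
    obtain ⟨s, t, hs, ht⟩ := exists_isBlock_ge hlt hex (max M N)
    obtain ⟨hst, hack⟩ := hbound s t ht.1
    have hlabel : label P (2 ^ (t + 1) ^ 2) = Sum.inr (s, 0, 0) := by
      simpa [blockValue] using label_blockValue ht (m := 0) (k := 0) (by omega) (by omega)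
    have hlarge : N ≤ 2 ^ (t + 1) ^ 2 := by
      have : t < 2 ^ (t + 1) ^ 2 := by simpa using lt_two_pow_sq_add t 0
      omega
    refine absurd (hN _ hlarge) (not_le.2 (lt_sq_of_encode_label_lt ht ?_))
    rw [← hGlabel, hlabel]
    exact ((hM _).trans_le (ack_mono_left _ ((le_max_left M N).trans hs))).trans hack
end
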